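/- Let (u,θ) be a classical solution of the thermal Navier–Stokes system on 𝕋³ × [0,T] with θ₀ ≥ 1 on 𝕋³. Then sup_{t ∈ [0,T]} ( ½‖u(·,t)‖²_{L²(𝕋³)} + ‖θ(·,t)‖²_{L²(𝕋³)} ) ≤ ½‖u₀‖²_{L²(𝕋³)} + ‖θ₀‖²_{L²(𝕋³)}. -/

import Mathlib

open MeasureTheory Real
open scoped ENNReal

noncomputable section

/-- Points of `ℝ³`; `ℤ³`-periodic functions on `Sp` model functions on the torus `𝕋³`. -/
abbrev Sp : Type := Fin 3 → ℝ

/-- A fundamental cell for the torus `𝕋³ = ℝ³/ℤ³`; integrals over `𝕋³` are integrals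
over `cell`. -/
def cell : Set Sp := Set.Icc 0 1

/-- The `i`-th partial derivative `∂ᵢ f`. -/
def pd (i : Fin 3) (f : Sp → ℝ) (x : Sp) : ℝ := fderiv ℝ f x (Pi.single i 1)

/-- `ℤ³`-periodicity: such a function descends to the torus `𝕋³`. -/
def Periodic3 (f : Sp → ℝ) : Prop :=
  ∀ (x : Sp) (k : Fin 3 → ℤ), f (x + fun i => (k i : ℝ)) = f x

/-- `|∇u|²` for a vector field `u`. -/
def gradSqV (u : Sp → Fin 3 → ℝ) (x : Sp) : ℝ :=
  ∑ i, ∑ j, (pd i (fun y => u y j) x) ^ 2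

/-- `|∇²u|²` for a vector field `u`. -/
def hessSqV (u : Sp → Fin 3 → ℝ) (x : Sp) : ℝ :=
  ∑ i, ∑ j, ∑ k, (pd i (pd j (fun y => u y k)) x) ^ 2

/-- `|∇f|²` for a scalar field `f`. -/
def gradSqS (f : Sp → ℝ) (x : Sp) : ℝ := ∑ i, (pd i f x) ^ 2

/-- An axis-parallel cube in `ℝ³` with base point `a` and side length `r`. -/
def cube (a : Sp) (r : ℝ) : Set Sp := Set.Icc a (a + fun _ => r)

/-- The average `|Q|⁻¹ ∫_Q f dx` of a nonnegative function, valued in `ℝ≥0∞`. -/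
def avgE (Q : Set Sp) (f : Sp → ℝ) : ℝ≥0∞ :=
  (volume Q)⁻¹ * ∫⁻ x in Q, ENNReal.ofReal (f x)

/-- The Muckenhoupt `A₂` characteristic `Q₂(ω)`, the supremum over all cubes `Q ⊆ 𝕋³`
(side length `≤ 1`) of `(|Q|⁻¹∫_Q ω dx)(|Q|⁻¹∫_Q ω⁻¹ dx)`; `ω ∈ A₂` iff `Q2 ω < ⊤`. -/
def Q2 (ω : Sp → ℝ) : ℝ≥0∞ :=
  ⨆ (a : Sp) (r : ℝ) (_ : 0 < r) (_ : r ≤ 1),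
    avgE (cube a r) ω * avgE (cube a r) fun x => (ω x)⁻¹

/-- A classical solution `(u, θ)` (with pressure `p`) of the thermal Navier–Stokes system
`∂ₜu + (u·∇)u + ∇p − ν div(θ∇u) = 0`, `div u = 0`,
`∂ₜ(θ²) + u·∇(θ²) − κ div(θ∇(θ²)) = νθ|∇u|²` on `𝕋³ × [0,T]`, with `p` the mean-zero
solution of `Δp = ∂ᵢ∂ⱼ(νθ∂ᵢuⱼ − uᵢuⱼ)`, initial data `u₀` mean-zero and `θ₀ ≥ 1`. -/
structure ThermalNSE (ν κ T : ℝ) (u : ℝ → Sp → Fin 3 → ℝ) (θ : ℝ → Sp → ℝ)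
    (p : ℝ → Sp → ℝ) : Prop where
  T_pos : 0 < T
  smooth_u : ContDiff ℝ (⊤ : ℕ∞) fun q : ℝ × Sp => u q.1 q.2
  smooth_θ : ContDiff ℝ (⊤ : ℕ∞) fun q : ℝ × Sp => θ q.1 q.2
  smooth_p : ContDiff ℝ (⊤ : ℕ∞) fun q : ℝ × Sp => p q.1 q.2
  periodic_u : ∀ t j, Periodic3 fun x => u t x j
  periodic_θ : ∀ t, Periodic3 (θ t)
  periodic_p : ∀ t, Periodic3 (p t)
  div_free : ∀ t ∈ Set.Icc (0 : ℝ) T, ∀ x, (∑ i, pd i (fun y => u t y i) x) = 0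
  momentum : ∀ t ∈ Set.Icc (0 : ℝ) T, ∀ x, ∀ j,
    deriv (fun s => u s x j) t
      + (∑ i, u t x i * pd i (fun y => u t y j) x)
      + pd j (p t) x
      - ν * ∑ i, pd i (fun y => θ t y * pd i (fun z => u t z j) y) x = 0
  heat : ∀ t ∈ Set.Icc (0 : ℝ) T, ∀ x,
    deriv (fun s => θ s x ^ 2) t
      + (∑ i, u t x i * pd i (fun y => θ t y ^ 2) x)
      - κ * (∑ i, pd i (fun y => θ t y * pd i (fun z => θ t z ^ 2) y) x)
      = ν * θ t x * gradSqV (u t) x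
  p_mean_zero : ∀ t ∈ Set.Icc (0 : ℝ) T, ∫ x in cell, p t x = 0
  p_poisson : ∀ t ∈ Set.Icc (0 : ℝ) T, ∀ x,
    (∑ i, pd i (pd i (p t)) x)
      = ∑ i, ∑ j, pd i (pd j fun y =>
          ν * θ t y * pd i (fun z => u t z j) y - u t y i * u t y j) x
  u0_mean_zero : ∀ j, ∫ x in cell, u 0 x j = 0
  θ0_ge_one : ∀ x, 1 ≤ θ 0 x

section PartialDerivatives

variable {f g : Sp → ℝ}

theorem pd_add (i : Fin 3) (hf : Differentiable ℝ f) (hg : Differentiable ℝ g) (x : Sp) :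
    pd i (fun y => f y + g y) x = pd i f x + pd i g x := by
  simp [pd, fderiv_fun_add (hf x) (hg x)]

theorem pd_sub (i : Fin 3) (hf : Differentiable ℝ f) (hg : Differentiable ℝ g) (x : Sp) :
    pd i (fun y => f y - g y) x = pd i f x - pd i g x := by
  simp [pd, fderiv_fun_sub (hf x) (hg x)]

theorem pd_mul (i : Fin 3) (hf : Differentiable ℝ f) (hg : Differentiable ℝ g) (x : Sp) :
    pd i (fun y => f y * g y) x = f x * pd i g x + g x * pd i f x := by
  simp [pd, fderiv_fun_mul (hf x) (hg x)]

theorem pd_const_mul (i : Fin 3) (c : ℝ) (hf : Differentiable ℝ f) (x : Sp) :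
    pd i (fun y => c * f y) x = c * pd i f x := by
  simp [pd, fderiv_const_mul (hf x)]

theorem pd_sum {ι : Type*} (s : Finset ι) (i : Fin 3) {F : ι → Sp → ℝ}
    (hF : ∀ j, Differentiable ℝ (F j)) (x : Sp) :
    pd i (fun y => ∑ j ∈ s, F j y) x = ∑ j ∈ s, pd i (F j) x := by
  simp [pd, fderiv_fun_sum fun j _ => hF j x]

theorem ContDiff.pd (i : Fin 3) (hf : ContDiff ℝ (⊤ : ℕ∞) f) :
    ContDiff ℝ (⊤ : ℕ∞) (pd i f) :=
  (hf.fderiv_right (m := (⊤ : ℕ∞)) (by simp)).clm_apply contDiff_const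

end PartialDerivatives

theorem Periodic3.pd {f : Sp → ℝ} (i : Fin 3) (hf : Periodic3 f) : Periodic3 (pd i f) := fun x k => by
  have h : (fun y => f (y + fun i => (k i : ℝ))) = f := funext fun y => hf y k
  unfold _root_.pd
  rw [← fderiv_comp_add_right, h]

/-- The divergence theorem on the torus. -/
theorem integral_cell_sum_pd_eq_zero {F : Fin 3 → Sp → ℝ} (hF : ∀ i, ContDiff ℝ (⊤ : ℕ∞) (F i))
    (hper : ∀ i, Periodic3 (F i)) : ∫ x in cell, ∑ i, pd i (F i) x = 0 := by
  have hdiv := integral_divergence_of_hasFDerivAt_off_countable' (0 : Sp) 1 zero_le_one F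
    (fun i => fderiv ℝ (F i)) ∅ Set.countable_empty (fun i => (hF i).continuous.continuousOn)
    (fun x _ i => ((hF i).differentiable (by simp) x).hasFDerivAt)
    ((continuous_finsetSum _ fun i _ => ((hF i).pd i).continuous).continuousOn.integrableOn_compact
      isCompact_Icc)
  refine hdiv.trans (Finset.sum_eq_zero fun i _ => sub_eq_zero.2 ?_)
  congr 1
  funext x
  rw [← hper i (i.insertNth ((0 : Sp) i) x) (Pi.single i 1)]
  congr 1
  funext j
  refine Fin.succAboveCases i ?_ (fun j => ?_) j <;> simp

/-- Differentiation under the integral sign over the torus. -/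
theorem hasDerivAt_integral_cell {f : ℝ × Sp → ℝ} (hf : ContDiff ℝ (⊤ : ℕ∞) f) (t : ℝ) :
    HasDerivAt (fun s => ∫ x in cell, f (s, x)) (∫ x in cell, deriv (fun s => f (s, x)) t) t := by
  have hd : ∀ s x, HasDerivAt (fun s => f (s, x)) (fderiv ℝ f (s, x) (1, 0)) s := fun s x =>
    ((hf.differentiable (by simp) (s, x)).hasFDerivAt).comp_hasDerivAt s
      ((hasDerivAt_id s).prodMk (hasDerivAt_const s x))
  have hc : Continuous fun q : ℝ × Sp => fderiv ℝ f q (1, 0) :=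
    (hf.continuous_fderiv (by simp)).clm_apply continuous_const
  obtain ⟨C, hC⟩ := ((isCompact_Icc (a := t - 1) (b := t + 1)).prod
    (isCompact_Icc (a := (0 : Sp)) (b := 1))).exists_bound_of_continuousOn hc.continuousOn
  have hcell : MeasurableSet cell := measurableSet_Icc
  have hint : ∀ {g : Sp → ℝ}, Continuous g → IntegrableOn g cell := fun hg =>
    hg.continuousOn.integrableOn_compact isCompact_Icc
  simp only [fun x => (hd t x).deriv]
  refine (hasDerivAt_integral_of_dominated_loc_of_deriv_le
    (F := fun s x => f (s, x)) (F' := fun s x => fderiv ℝ f (s, x) (1, 0)) (bound := fun _ => C)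
    (Icc_mem_nhds (sub_one_lt t) (lt_add_one t))
    (.of_forall fun s => (hint ?_).aestronglyMeasurable)
    (hint ?_) (hint ?_).aestronglyMeasurable ?_ (hint continuous_const)
    (.of_forall fun x s _ => hd s x)).2
  · exact hf.continuous.comp (by fun_prop)
  · exact hf.continuous.comp (by fun_prop)
  · exact hc.comp (by fun_prop)
  · exact (ae_restrict_mem hcell).mono fun x hx s hs => hC (s, x) ⟨hs, hx⟩

/-- The flux of the energy density `½|u|² + θ²`. -/
def energyFlux (ν κ : ℝ) (u : Sp → Fin 3 → ℝ) (θ p : Sp → ℝ) (i : Fin 3) (x : Sp) : ℝ :=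
  κ * (θ x * pd i (fun y => θ y ^ 2) x) - u x i * θ x ^ 2 - u x i * p x
    + ∑ j, (ν * (u x j * (θ x * pd i (fun y => u y j) x)) - 1 / 2 * (u x i * (u x j * u x j)))

theorem contDiff_energyFlux (ν κ : ℝ) {u : Sp → Fin 3 → ℝ} {θ p : Sp → ℝ}
    (hu : ∀ j, ContDiff ℝ (⊤ : ℕ∞) fun x => u x j) (hθ : ContDiff ℝ (⊤ : ℕ∞) θ)
    (hp : ContDiff ℝ (⊤ : ℕ∞) p) (i : Fin 3) :
    ContDiff ℝ (⊤ : ℕ∞) (energyFlux ν κ u θ p i) :=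
  (((contDiff_const.mul (hθ.mul ((hθ.pow 2).pd i))).sub ((hu i).mul (hθ.pow 2))).sub
    ((hu i).mul hp)).add <| ContDiff.sum fun j _ =>
      (contDiff_const.mul ((hu j).mul (hθ.mul ((hu j).pd i)))).sub
        (contDiff_const.mul ((hu i).mul ((hu j).mul (hu j))))

theorem periodic_energyFlux (ν κ : ℝ) {u : Sp → Fin 3 → ℝ} {θ p : Sp → ℝ}
    (hu : ∀ j, Periodic3 fun x => u x j) (hθ : Periodic3 θ) (hp : Periodic3 p) (i : Fin 3) :
    Periodic3 (energyFlux ν κ u θ p i) := fun x k => by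
  have hθ2 : Periodic3 fun x => θ x ^ 2 := fun x k => by simp only [hθ x k]
  simp only [energyFlux, hθ x k, hp x k, hθ2.pd i x k, fun j => hu j x k,
    fun j => (hu j).pd i x k]

theorem pd_energyFlux (ν κ : ℝ) {u : Sp → Fin 3 → ℝ} {θ p : Sp → ℝ}
    (hu : ∀ j, ContDiff ℝ (⊤ : ℕ∞) fun x => u x j) (hθ : ContDiff ℝ (⊤ : ℕ∞) θ)
    (hp : ContDiff ℝ (⊤ : ℕ∞) p) (i : Fin 3) (x : Sp) :
    pd i (energyFlux ν κ u θ p i) x =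
      κ * pd i (fun y => θ y * pd i (fun z => θ z ^ 2) y) x
        - (u x i * pd i (fun y => θ y ^ 2) x + θ x ^ 2 * pd i (fun y => u y i) x)
        - (u x i * pd i p x + p x * pd i (fun y => u y i) x)
        + ∑ j, (ν * (u x j * pd i (fun y => θ y * pd i (fun z => u z j) y) x
            + θ x * pd i (fun y => u y j) x * pd i (fun y => u y j) x)
          - 1 / 2 * (u x i * (u x j * pd i (fun y => u y j) x + u x j * pd i (fun y => u y j) x)
            + u x j * u x j * pd i (fun y => u y i) x)) := by
  have d : ∀ {f : Sp → ℝ}, ContDiff ℝ (⊤ : ℕ∞) f → Differentiable ℝ f := fun hf =>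
    hf.differentiable (by simp)
  have hθ2 := hθ.pow 2
  have hV := fun j => hθ.mul ((hu j).pd i)
  have huu := fun j => (hu j).mul (hu j)
  have h1 := hθ.mul (hθ2.pd i)
  have h2 := fun j => (hu j).mul (hV j)
  have h3 := fun j => (hu i).mul (huu j)
  have c1 := (contDiff_const (c := κ)).mul h1
  have c2 := (hu i).mul hθ2
  have c3 := (hu i).mul hp
  have c4 := fun j => (contDiff_const (c := ν)).mul (h2 j)
  have c5 := fun j => (contDiff_const (c := (1 / 2 : ℝ))).mul (h3 j)
  unfold energyFlux
  rw [pd_add i (d ((c1.sub c2).sub c3)) (d (ContDiff.sum fun j _ => (c4 j).sub (c5 j))),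
    pd_sub i (d (c1.sub c2)) (d c3), pd_sub i (d c1) (d c2), pd_const_mul i κ (d h1),
    pd_mul i (d (hu i)) (d hθ2), pd_mul i (d (hu i)) (d hp),
    pd_sum _ i (fun j => d ((c4 j).sub (c5 j)))]
  congr 1
  refine Finset.sum_congr rfl fun j _ => ?_
  rw [pd_sub i (d (c4 j)) (d (c5 j)), pd_const_mul i ν (d (h2 j)),
    pd_const_mul i (1 / 2) (d (h3 j)), pd_mul i (d (hu j)) (d (hV j)),
    pd_mul i (d (hu i)) (d (huu j)), pd_mul i (d (hu j)) (d (hu j))]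

/-- The energy density `½|u|² + θ²` obeys a conservation law. -/
theorem ThermalNSE.deriv_energyDensity {ν κ T : ℝ} {u : ℝ → Sp → Fin 3 → ℝ} {θ p : ℝ → Sp → ℝ}
    (h : ThermalNSE ν κ T u θ p) {t : ℝ} (ht : t ∈ Set.Icc (0 : ℝ) T) (x : Sp) :
    deriv (fun s => 1 / 2 * ∑ j, u s x j ^ 2 + θ s x ^ 2) t =
      ∑ i, pd i (energyFlux ν κ (u t) (θ t) (p t) i) x := by
  have hline : ContDiff ℝ (⊤ : ℕ∞) fun s : ℝ => (s, x) := by fun_prop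
  have hslice : ContDiff ℝ (⊤ : ℕ∞) fun y : Sp => (t, y) := by fun_prop
  have hu : ∀ j, ContDiff ℝ (⊤ : ℕ∞) fun y => u t y j :=
    contDiff_pi.1 (h.smooth_u.comp hslice)
  have hθ : ContDiff ℝ (⊤ : ℕ∞) (θ t) := h.smooth_θ.comp hslice
  have hp : ContDiff ℝ (⊤ : ℕ∞) (p t) := h.smooth_p.comp hslice
  have hut : ∀ j, HasDerivAt (fun s => u s x j) (deriv (fun s => u s x j) t) t := fun j =>
    ((contDiff_pi.1 (h.smooth_u.comp hline) j).differentiable (by simp) t).hasDerivAt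
  have hθt : HasDerivAt (fun s => θ s x ^ 2) (deriv (fun s => θ s x ^ 2) t) t :=
    (((h.smooth_θ.comp hline).pow 2).differentiable (by simp) t).hasDerivAt
  have hD := ((HasDerivAt.fun_sum fun j (_ : j ∈ Finset.univ) => (hut j).fun_pow 2).const_mul
    (1 / 2 : ℝ)).fun_add hθt
  rw [hD.deriv, Finset.sum_congr rfl fun i _ => pd_energyFlux ν κ hu hθ hp i x]
  have hm := h.momentum t ht x
  have hh := h.heat t ht x
  have hdiv := h.div_free t ht x
  simp only [gradSqV, Fin.sum_univ_three, Nat.cast_ofNat, Nat.add_one_sub_one, pow_one] at hm hh hdiv ⊢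
  linear_combination u t x 0 * hm 0 + u t x 1 * hm 1 + u t x 2 * hm 2 + hh
    + (θ t x ^ 2 + p t x + 1 / 2 * (u t x 0 ^ 2 + u t x 1 ^ 2 + u t x 2 ^ 2)) * hdiv

/-- **Proposition 2.1 (energy bound), thermal Navier–Stokes.**
`sup_{t∈[0,T]} (½‖u(t)‖²_{L²} + ‖θ(t)‖²_{L²}) ≤ ½‖u₀‖²_{L²} + ‖θ₀‖²_{L²}`. -/
theorem thermalNSE_energy_bound (ν κ T : ℝ) (hν : 0 < ν) (hκ : 0 < κ)
    (u : ℝ → Sp → Fin 3 → ℝ) (θ p : ℝ → Sp → ℝ)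
    (h : ThermalNSE ν κ T u θ p) :
    ∀ t ∈ Set.Icc (0 : ℝ) T,
      (1 / 2) * (∫ x in cell, ∑ j, u t x j ^ 2) + (∫ x in cell, θ t x ^ 2)
        ≤ (1 / 2) * (∫ x in cell, ∑ j, u 0 x j ^ 2) + ∫ x in cell, θ 0 x ^ 2 := by
  have hu : ∀ j, ContDiff ℝ (⊤ : ℕ∞) fun q : ℝ × Sp => u q.1 q.2 j := contDiff_pi.1 h.smooth_u
  have hkin : ContDiff ℝ (⊤ : ℕ∞) fun q : ℝ × Sp => ∑ j, u q.1 q.2 j ^ 2 :=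
    ContDiff.sum fun j _ => (hu j).pow 2
  have hheat := h.smooth_θ.pow 2
  have hE : ∀ t ∈ Set.Icc (0 : ℝ) T, HasDerivAt
      (fun s => ∫ x in cell, (1 / 2 * ∑ j, u s x j ^ 2 + θ s x ^ 2)) 0 t := fun t ht => by
    have hslice : ContDiff ℝ (⊤ : ℕ∞) fun y : Sp => (t, y) := by fun_prop
    have hderiv := hasDerivAt_integral_cell (((contDiff_const (c := (1 / 2 : ℝ))).mul hkin).add hheat) t
    rwa [integral_congr_ae (.of_forall fun x => h.deriv_energyDensity ht x),
      integral_cell_sum_pd_eq_zero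
        (contDiff_energyFlux ν κ (u := u t) (θ := θ t) (p := p t)
          (fun j => (hu j).comp hslice) (h.smooth_θ.comp hslice) (h.smooth_p.comp hslice))
        (periodic_energyFlux ν κ (h.periodic_u t) (h.periodic_θ t) (h.periodic_p t))] at hderiv
  have hsplit : ∀ t, ∫ x in cell, (1 / 2 * ∑ j, u t x j ^ 2 + θ t x ^ 2) =
      1 / 2 * (∫ x in cell, ∑ j, u t x j ^ 2) + ∫ x in cell, θ t x ^ 2 := fun t => by
    have hslice : Continuous fun y : Sp => (t, y) := by fun_prop
    have hint : ∀ {g : Sp → ℝ}, Continuous g → IntegrableOn g cell := fun hg =>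
      hg.continuousOn.integrableOn_compact isCompact_Icc
    have hkin_int : IntegrableOn (fun x => ∑ j, u t x j ^ 2) cell :=
      hint (hkin.continuous.comp hslice)
    have hheat_int : IntegrableOn (fun x => θ t x ^ 2) cell :=
      hint (hheat.continuous.comp hslice)
    rw [integral_add (hkin_int.const_mul (1 / 2)) hheat_int, integral_const_mul]
  intro t ht
  rw [← hsplit t, ← hsplit 0]
  exact (constant_of_has_deriv_right_zero
    (fun s hs => (hE s hs).continuousAt.continuousWithinAt)
    (fun s hs => (hE s (Set.Ico_subset_Icc_self hs)).hasDerivWithinAt) t ht).le
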